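/- arXiv:2108.03812 — 4 statements merged into one kernel-verified Lean document; each statement's English description precedes it below -/
import Mathlib

section
/- If p11 > p01, then for every horizon T ≥ 1 the finite-horizon value function V_T is monotonically nondecreasing on [0,1]: for all ω, ω' ∈ [0,1] with ω ≤ ω', V_T(ω) ≤ V_T(ω'). -/
/-- One-step belief update without observation: `T(ω) = ω·p11 + (1−ω)·p01`. -/
noncomputable def Tmap (p01 p11 ω : ℝ) : ℝ := ω * p11 + (1 - ω) * p01

/-- Belief update after a failed observation: `φ(ω) = εω/(εω + 1 − ω)`. -/
noncomputable def phi (ε ω : ℝ) : ℝ := ε * ω / (ε * ω + 1 - ω)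

/-- Finite-horizon value function `V_T` of the single-armed bandit with subsidy `m`:
`V_0 ≡ 0` and `V_T(ω) = max{V_T(ω;u=1), V_T(ω;u=0)}`. -/
noncomputable def Vfin (p01 p11 ε β m : ℝ) : ℕ → ℝ → ℝ
  | 0, _ => 0
  | T + 1, ω =>
      max ((1 - ε) * ω + β * ((1 - ε) * ω * Vfin p01 p11 ε β m T p11
            + (1 - (1 - ε) * ω) * Vfin p01 p11 ε β m T (Tmap p01 p11 (phi ε ω))))
          (m + β * Vfin p01 p11 ε β m T (Tmap p01 p11 ω))

lemma phi_denom_pos {ε ω : ℝ} (hε : 0 < ε) (hω : ω ∈ Set.Icc (0:ℝ) 1) :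
    0 < ε * ω + 1 - ω := by
  rcases hω.2.eq_or_lt with rfl | h
  · simpa using hε
  · linarith [mul_nonneg hε.le hω.1]

lemma phi_mem_Icc {ε ω : ℝ} (hε : 0 < ε) (hω : ω ∈ Set.Icc (0:ℝ) 1) :
    phi ε ω ∈ Set.Icc (0:ℝ) 1 := by
  have hd := phi_denom_pos hε hω
  refine ⟨div_nonneg (mul_nonneg hε.le hω.1) hd.le, (div_le_one hd).2 ?_⟩
  linarith [hω.2]

lemma phi_monotoneOn {ε : ℝ} (hε : 0 < ε) : MonotoneOn (phi ε) (Set.Icc 0 1) := by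
  intro ω hω ω' hω' h
  refine (div_le_div_iff₀ (phi_denom_pos hε hω) (phi_denom_pos hε hω')).2 ?_
  nlinarith [mul_le_mul_of_nonneg_left h hε.le]

lemma Tmap_monotone {p01 p11 : ℝ} (h : p01 ≤ p11) : Monotone (Tmap p01 p11) := by
  intro ω ω' hω
  unfold Tmap
  nlinarith [mul_nonneg (sub_nonneg.2 h) (sub_nonneg.2 hω)]

lemma Tmap_one (p01 p11 : ℝ) : Tmap p01 p11 1 = p11 := by
  simp [Tmap]

lemma Tmap_zero (p01 p11 : ℝ) : Tmap p01 p11 0 = p01 := by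
  simp [Tmap]

lemma Tmap_mem_Icc {p01 p11 ω : ℝ} (h : p01 ≤ p11) (h0 : 0 ≤ p01) (h1 : p11 ≤ 1)
    (hω : ω ∈ Set.Icc (0:ℝ) 1) : Tmap p01 p11 ω ∈ Set.Icc (0:ℝ) 1 := by
  have hlo := Tmap_monotone h hω.1
  have hhi := Tmap_monotone h hω.2
  rw [Tmap_zero] at hlo
  rw [Tmap_one] at hhi
  exact ⟨h0.trans hlo, hhi.trans h1⟩

lemma Vfin_monotoneOn {p01 p11 ε β : ℝ} (m : ℝ) (h0 : 0 ≤ p01) (h1 : p11 ≤ 1)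
    (h : p01 ≤ p11) (hε : ε ∈ Set.Ioc (0:ℝ) 1) (hβ : 0 ≤ β) (T : ℕ) :
    MonotoneOn (Vfin p01 p11 ε β m T) (Set.Icc 0 1) := by
  induction T with
  | zero => intro ω _ ω' _ _; simp [Vfin]
  | succ T ih =>
    intro ω hω ω' hω' hle
    simp only [Vfin]
    have hφ := phi_mem_Icc hε.1 hω
    have hφ' := phi_mem_Icc hε.1 hω'
    have hT := Tmap_mem_Icc h h0 h1 hφ
    have hT' := Tmap_mem_Icc h h0 h1 hφ'
    have hfail := ih hT hT' (Tmap_monotone h (phi_monotoneOn hε.1 hω hω' hle))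
    have hp11 : Tmap p01 p11 (phi ε ω') ≤ p11 :=
      (Tmap_monotone h hφ'.2).trans_eq (Tmap_one p01 p11)
    have hsucc := ih hT' ⟨h0.trans h, h1⟩ hp11
    have hpass := ih (Tmap_mem_Icc h h0 h1 hω) (Tmap_mem_Icc h h0 h1 hω')
      (Tmap_monotone h hle)
    have hprob : (1 - ε) * ω ≤ (1 - ε) * ω' :=
      mul_le_mul_of_nonneg_left hle (sub_nonneg.2 hε.2)
    have hprob_le : 0 ≤ 1 - (1 - ε) * ω := by
      linarith [phi_denom_pos hε.1 hω]
    refine max_le_max (add_le_add hprob (mul_le_mul_of_nonneg_left ?_ hβ))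
      (add_le_add_right (mul_le_mul_of_nonneg_left hpass hβ) m)
    nlinarith [mul_le_mul_of_nonneg_left hfail hprob_le,
      mul_nonneg (sub_nonneg.2 hprob) (sub_nonneg.2 hsucc)]

/-- If `p11 > p01`, then every finite-horizon value function `V_T` (`T ≥ 1`) is
monotonically nondecreasing on `[0,1]`. -/
theorem Vfin_monotone (p01 p11 ε β m : ℝ)
    (hp01 : p01 ∈ Set.Ioo (0:ℝ) 1) (hp11 : p11 ∈ Set.Ioo (0:ℝ) 1)
    (hne : p01 ≠ p11) (hε : ε ∈ Set.Ioo (0:ℝ) 1) (hβ : β ∈ Set.Ioo (0:ℝ) 1)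
    (hpos : p01 < p11) :
    ∀ T : ℕ, 1 ≤ T → ∀ ω ∈ Set.Icc (0:ℝ) 1, ∀ ω' ∈ Set.Icc (0:ℝ) 1,
      ω ≤ ω' → Vfin p01 p11 ε β m T ω ≤ Vfin p01 p11 ε β m T ω' := by
  intro T _ ω hω ω' hω' hle
  exact Vfin_monotoneOn m hp01.1.le hp11.2.le hpos.le ⟨hε.1, hε.2.le⟩ hβ.1.le T hω hω' hle
end

section
/- Suppose either (i) p11 > p01 and β ≤ 1/((3−ε)·(p11 − p01)), or (ii) p01 > p11 and β ≤ 1/((5−2ε)·(p01 − p11)). Then the infinite-horizon difference function h(ω) = V_{β,m}(ω;u=1) − V_{β,m}(ω;u=0) is monotonically nondecreasing on [0,1]; consequently the infinite-horizon optimal single-arm policy is a threshold policy: there exists ω*_β(m) ∈ ℝ such that for every ω ∈ [0,1], V_{β,m}(ω;u=1) > V_{β,m}(ω;u=0) if and only if ω > ω*_β(m). -/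
/-- Active-branch of the Bellman operator: the expected total discounted reward
of activating now and continuing with value function `f`. -/
noncomputable def actV (p01 p11 ε β : ℝ) (f : ℝ → ℝ) (ω : ℝ) : ℝ :=
  (1 - ε) * ω + β * ((1 - ε) * ω * f p11
    + (1 - (1 - ε) * ω) * f (Tmap p01 p11 (phi ε ω)))

/-- Passive-branch of the Bellman operator: subsidy `m` plus discounted
continuation with value function `f`. -/
noncomputable def pasV (p01 p11 β m : ℝ) (f : ℝ → ℝ) (ω : ℝ) : ℝ :=
  m + β * f (Tmap p01 p11 ω)

/-- The Bellman operator `B` of the single-armed bandit with subsidy `m`. -/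
noncomputable def Bop (p01 p11 ε β m : ℝ) (f : ℝ → ℝ) (ω : ℝ) : ℝ :=
  max (actV p01 p11 ε β f ω) (pasV p01 p11 β m f ω)

/-- Expected continuation value of the active action. -/
noncomputable def actCont (p01 p11 ε : ℝ) (f : ℝ → ℝ) (ω : ℝ) : ℝ :=
  (1 - ε) * ω * f p11 + (1 - (1 - ε) * ω) * f (Tmap p01 p11 (phi ε ω))

theorem actV_eq (p01 p11 ε β : ℝ) (f : ℝ → ℝ) (ω : ℝ) :
    actV p01 p11 ε β f ω = (1 - ε) * ω + β * actCont p01 p11 ε f ω := rfl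

theorem Tmap_mem {p01 p11 ω : ℝ} (hp01 : p01 ∈ Set.Ioo (0:ℝ) 1) (hp11 : p11 ∈ Set.Ioo (0:ℝ) 1)
    (hω : ω ∈ Set.Icc (0:ℝ) 1) : Tmap p01 p11 ω ∈ Set.Icc (0:ℝ) 1 := by
  obtain ⟨h0, h1⟩ := hω
  obtain ⟨a0, a1⟩ := hp01
  obtain ⟨b0, b1⟩ := hp11
  unfold Tmap
  constructor <;> nlinarith

theorem Tmap_sub (p01 p11 x y : ℝ) :
    Tmap p01 p11 y - Tmap p01 p11 x = (p11 - p01) * (y - x) := by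
  unfold Tmap; ring

theorem sub_Tmap (p01 p11 x : ℝ) : p11 - Tmap p01 p11 x = (p11 - p01) * (1 - x) := by
  unfold Tmap; ring

theorem failProb_pos {ε ω : ℝ} (hε : ε ∈ Set.Ioo (0:ℝ) 1) (hω : ω ∈ Set.Icc (0:ℝ) 1) :
    0 < 1 - (1 - ε) * ω := by
  nlinarith [hε.1, hε.2, hω.1, hω.2, mul_nonneg (sub_nonneg.2 hε.2.le) (sub_nonneg.2 hω.2)]

theorem phi_mem {ε ω : ℝ} (hε : ε ∈ Set.Ioo (0:ℝ) 1) (hω : ω ∈ Set.Icc (0:ℝ) 1) :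
    phi ε ω ∈ Set.Icc (0:ℝ) 1 := by
  have h := failProb_pos hε hω
  have e : ε * ω + 1 - ω = 1 - (1 - ε) * ω := by ring
  unfold phi
  rw [e]
  exact ⟨div_nonneg (mul_nonneg hε.1.le hω.1) h.le, by rw [div_le_one h]; linarith [hω.2]⟩

theorem failProb_mul_phi_sub {ε x y : ℝ} (hε : ε ∈ Set.Ioo (0:ℝ) 1)
    (hx : x ∈ Set.Icc (0:ℝ) 1) (hy : y ∈ Set.Icc (0:ℝ) 1) :
    (1 - (1 - ε) * y) * (phi ε y - phi ε x) = (y - x) * (1 - (1 - ε) * (1 - phi ε x)) := by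
  have h := failProb_pos hε hx
  have h' := failProb_pos hε hy
  have e : ε * x + 1 - x = 1 - (1 - ε) * x := by ring
  have e' : ε * y + 1 - y = 1 - (1 - ε) * y := by ring
  unfold phi
  rw [e, e']
  field_simp
  ring

theorem phi_mono {ε x y : ℝ} (hε : ε ∈ Set.Ioo (0:ℝ) 1)
    (hx : x ∈ Set.Icc (0:ℝ) 1) (hy : y ∈ Set.Icc (0:ℝ) 1) (hxy : x ≤ y) :
    phi ε x ≤ phi ε y := by
  have h := failProb_pos hε hy
  have e := failProb_mul_phi_sub hε hx hy
  have hr : 0 ≤ (y - x) * (1 - (1 - ε) * (1 - phi ε x)) :=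
    mul_nonneg (sub_nonneg.2 hxy) <| by
      nlinarith [hε.1, hε.2, (phi_mem hε hx).1, (phi_mem hε hx).2]
  rw [← e] at hr
  linarith [nonneg_of_mul_nonneg_right hr h]

theorem actCont_sub (p01 p11 ε : ℝ) (f : ℝ → ℝ) (x y : ℝ) :
    actCont p01 p11 ε f y - actCont p01 p11 ε f x =
      (1 - ε) * (y - x) * (f p11 - f (Tmap p01 p11 (phi ε x))) +
      (1 - (1 - ε) * y) * (f (Tmap p01 p11 (phi ε y)) - f (Tmap p01 p11 (phi ε x))) := by
  unfold actCont; ring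

/-- The two increments in `actCont_sub` carry total weight at most one. -/
theorem actCont_weights {ε x y e : ℝ} (hε : ε ∈ Set.Ioo (0:ℝ) 1) (hx : x ∈ Set.Icc (0:ℝ) 1)
    (he : 0 ≤ e) : ((1 - ε) * (y - x) + (1 - (1 - ε) * y)) * e ≤ e := by
  nlinarith [mul_nonneg (mul_nonneg (sub_nonneg.2 hε.2.le) hx.1) he]

theorem actCont_lipschitz {p01 p11 ε L e : ℝ} {f : ℝ → ℝ}
    (hp01 : p01 ∈ Set.Ioo (0:ℝ) 1) (hp11 : p11 ∈ Set.Ioo (0:ℝ) 1) (hε : ε ∈ Set.Ioo (0:ℝ) 1)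
    (he : 0 ≤ e)
    (hf : ∀ x ∈ Set.Icc (0:ℝ) 1, ∀ y ∈ Set.Icc (0:ℝ) 1, |f y - f x| ≤ L * |y - x| + e)
    {x y : ℝ} (hx : x ∈ Set.Icc (0:ℝ) 1) (hy : y ∈ Set.Icc (0:ℝ) 1) (hxy : x ≤ y) :
    |actCont p01 p11 ε f y - actCont p01 p11 ε f x| ≤ L * |p11 - p01| * (y - x) + e := by
  have hφx := phi_mem hε hx
  have hφy := phi_mem hε hy
  have hd := failProb_pos hε hy
  have hw : 0 ≤ (1 - ε) * (y - x) := mul_nonneg (sub_nonneg.2 hε.2.le) (sub_nonneg.2 hxy)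
  have h₁ := hf _ (Tmap_mem hp01 hp11 hφx) _ (Set.Ioo_subset_Icc_self hp11)
  have h₂ := hf _ (Tmap_mem hp01 hp11 hφx) _ (Tmap_mem hp01 hp11 hφy)
  rw [sub_Tmap, abs_mul, abs_of_nonneg (sub_nonneg.2 hφx.2)] at h₁
  rw [Tmap_sub, abs_mul, abs_of_nonneg (sub_nonneg.2 (phi_mono hε hx hy hxy))] at h₂
  rw [actCont_sub]
  refine (abs_add_le _ _).trans ?_
  rw [abs_mul, abs_mul (1 - (1 - ε) * y), abs_of_nonneg hw, abs_of_pos hd]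
  have k₁ := mul_le_mul_of_nonneg_left h₁ hw
  have k₂ := mul_le_mul_of_nonneg_left h₂ hd.le
  have k₃ := actCont_weights (y := y) hε hx he
  have k₄ := congrArg (fun z => L * |p11 - p01| * z) (failProb_mul_phi_sub hε hx hy)
  linarith

theorem actCont_mono {p01 p11 ε e : ℝ} {f : ℝ → ℝ}
    (hp01 : p01 ∈ Set.Ioo (0:ℝ) 1) (hp11 : p11 ∈ Set.Ioo (0:ℝ) 1) (hε : ε ∈ Set.Ioo (0:ℝ) 1)
    (hp : p01 ≤ p11) (he : 0 ≤ e)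
    (hf : ∀ x ∈ Set.Icc (0:ℝ) 1, ∀ y ∈ Set.Icc (0:ℝ) 1, x ≤ y → f x ≤ f y + e)
    {x y : ℝ} (hx : x ∈ Set.Icc (0:ℝ) 1) (hy : y ∈ Set.Icc (0:ℝ) 1) (hxy : x ≤ y) :
    actCont p01 p11 ε f x ≤ actCont p01 p11 ε f y + e := by
  have hφx := phi_mem hε hx
  have hφy := phi_mem hε hy
  have hd := failProb_pos hε hy
  have hw : 0 ≤ (1 - ε) * (y - x) := mul_nonneg (sub_nonneg.2 hε.2.le) (sub_nonneg.2 hxy)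
  have h₁ := hf _ (Tmap_mem hp01 hp11 hφx) _ (Set.Ioo_subset_Icc_self hp11) <| by
    rw [← sub_nonneg, sub_Tmap]
    exact mul_nonneg (sub_nonneg.2 hp) (sub_nonneg.2 hφx.2)
  have h₂ := hf _ (Tmap_mem hp01 hp11 hφx) _ (Tmap_mem hp01 hp11 hφy) <| by
    rw [← sub_nonneg, Tmap_sub]
    exact mul_nonneg (sub_nonneg.2 hp) (sub_nonneg.2 (phi_mono hε hx hy hxy))
  have k := actCont_sub p01 p11 ε f x y
  have k₁ := mul_le_mul_of_nonneg_left h₁ hw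
  have k₂ := mul_le_mul_of_nonneg_left h₂ hd.le
  have k₃ := actCont_weights (y := y) hε hx he
  linarith

/-- An error bound that improves by the factor `β` may be replaced by zero. -/
theorem error_zero_of_contract {β C : ℝ} (hβ : β ∈ Set.Ioo (0:ℝ) 1) (hC : 0 ≤ C) {ι : Sort*}
    {a b : ι → ℝ} (h0 : ∀ i, a i ≤ b i + C)
    (hstep : ∀ e, 0 ≤ e → (∀ i, a i ≤ b i + e) → ∀ i, a i ≤ b i + β * e) (i : ι) :
    a i ≤ b i := by
  have h : ∀ n : ℕ, ∀ i, a i ≤ b i + β ^ n * C := by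
    intro n
    induction n with
    | zero => simpa using h0
    | succ n ih =>
      have := hstep _ (mul_nonneg (pow_nonneg hβ.1.le n) hC) ih
      simpa only [pow_succ', mul_assoc] using this
  have ht : Filter.Tendsto (fun n : ℕ => b i + β ^ n * C) Filter.atTop (nhds (b i + 0 * C)) :=
    ((tendsto_pow_atTop_nhds_zero_of_lt_one hβ.1.le hβ.2).mul_const C).const_add _
  simpa using ge_of_tendsto' ht fun n => h n i

theorem fixedPoint_lipschitz {p01 p11 ε β m L : ℝ} {V : ℝ → ℝ}
    (hp01 : p01 ∈ Set.Ioo (0:ℝ) 1) (hp11 : p11 ∈ Set.Ioo (0:ℝ) 1)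
    (hε : ε ∈ Set.Ioo (0:ℝ) 1) (hβ : β ∈ Set.Ioo (0:ℝ) 1)
    (hVbdd : ∃ C, ∀ ω ∈ Set.Icc (0:ℝ) 1, |V ω| ≤ C)
    (hVfix : ∀ ω ∈ Set.Icc (0:ℝ) 1, V ω = Bop p01 p11 ε β m V ω)
    (hL : 0 ≤ L) (hLeq : (1 - ε) + β * |p11 - p01| * L = L) :
    ∀ x ∈ Set.Icc (0:ℝ) 1, ∀ y ∈ Set.Icc (0:ℝ) 1, |V y - V x| ≤ L * |y - x| := by
  obtain ⟨C, hC⟩ := hVbdd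
  have hC0 : 0 ≤ C := (abs_nonneg _).trans (hC 0 (by simp))
  have key := error_zero_of_contract (ι := Set.Icc (0:ℝ) 1 × Set.Icc (0:ℝ) 1) hβ
    (by positivity : 0 ≤ C + C) (a := fun i => |V i.2 - V i.1|)
    (b := fun i => L * |(i.2 : ℝ) - i.1|) ?_ ?_
  · exact fun x hx y hy => key (⟨x, hx⟩, ⟨y, hy⟩)
  · rintro ⟨⟨x, hx⟩, ⟨y, hy⟩⟩
    have := mul_nonneg hL (abs_nonneg (y - x))
    exact (abs_sub _ _).trans (by linarith [hC x hx, hC y hy])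
  · intro e he ih
    have hf : ∀ x ∈ Set.Icc (0:ℝ) 1, ∀ y ∈ Set.Icc (0:ℝ) 1,
        |V y - V x| ≤ L * |y - x| + e := fun x hx y hy => ih (⟨x, hx⟩, ⟨y, hy⟩)
    have main : ∀ x ∈ Set.Icc (0:ℝ) 1, ∀ y ∈ Set.Icc (0:ℝ) 1, x ≤ y →
        |V y - V x| ≤ L * |y - x| + β * e := by
      intro x hx y hy hxy
      have hδ := sub_nonneg.2 hxy
      have hε' := sub_nonneg.2 hε.2.le
      rw [hVfix x hx, hVfix y hy, abs_of_nonneg hδ]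
      refine (abs_max_sub_max_le_max _ _ _ _).trans (max_le ?_ ?_)
      · have h := mul_le_mul_of_nonneg_left
          (actCont_lipschitz hp01 hp11 hε he hf hx hy hxy) hβ.1.le
        have e₁ : actV p01 p11 ε β V y - actV p01 p11 ε β V x = (1 - ε) * (y - x) +
            β * (actCont p01 p11 ε V y - actCont p01 p11 ε V x) := by
          rw [actV_eq, actV_eq]; ring
        rw [e₁]
        refine (abs_add_le _ _).trans ?_
        rw [abs_of_nonneg (mul_nonneg hε' hδ), abs_mul, abs_of_pos hβ.1]
        have := congrArg (fun z => z * (y - x)) hLeq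
        linarith
      · have h := mul_le_mul_of_nonneg_left
          (hf _ (Tmap_mem hp01 hp11 hx) _ (Tmap_mem hp01 hp11 hy)) hβ.1.le
        rw [Tmap_sub, abs_mul, abs_of_nonneg hδ] at h
        have e₁ : pasV p01 p11 β m V y - pasV p01 p11 β m V x =
            β * (V (Tmap p01 p11 y) - V (Tmap p01 p11 x)) := by
          unfold pasV; ring
        rw [e₁, abs_mul, abs_of_pos hβ.1]
        have := congrArg (fun z => z * (y - x)) hLeq
        linarith [mul_nonneg hε' hδ]
    rintro ⟨⟨x, hx⟩, ⟨y, hy⟩⟩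
    rcases le_total x y with hxy | hxy
    · exact main x hx y hy hxy
    · have := main y hy x hx hxy
      rwa [abs_sub_comm, abs_sub_comm x y] at this

theorem fixedPoint_mono {p01 p11 ε β m : ℝ} {V : ℝ → ℝ}
    (hp01 : p01 ∈ Set.Ioo (0:ℝ) 1) (hp11 : p11 ∈ Set.Ioo (0:ℝ) 1)
    (hε : ε ∈ Set.Ioo (0:ℝ) 1) (hβ : β ∈ Set.Ioo (0:ℝ) 1)
    (hVbdd : ∃ C, ∀ ω ∈ Set.Icc (0:ℝ) 1, |V ω| ≤ C)
    (hVfix : ∀ ω ∈ Set.Icc (0:ℝ) 1, V ω = Bop p01 p11 ε β m V ω) (hp : p01 ≤ p11) :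
    MonotoneOn V (Set.Icc (0:ℝ) 1) := by
  obtain ⟨C, hC⟩ := hVbdd
  have hC0 : 0 ≤ C := (abs_nonneg _).trans (hC 0 (by simp))
  have key := error_zero_of_contract
    (ι := {i : Set.Icc (0:ℝ) 1 × Set.Icc (0:ℝ) 1 // i.1 ≤ i.2}) hβ
    (by positivity : 0 ≤ C + C) (a := fun i => V i.1.1) (b := fun i => V i.1.2) ?_ ?_
  · exact fun x hx y hy hxy => key ⟨(⟨x, hx⟩, ⟨y, hy⟩), hxy⟩
  · rintro ⟨⟨⟨x, hx⟩, ⟨y, hy⟩⟩, -⟩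
    have h₁ := le_of_abs_le (hC x hx)
    have h₂ := neg_le_of_abs_le (hC y hy)
    dsimp only
    linarith
  · intro e he ih
    have hf : ∀ x ∈ Set.Icc (0:ℝ) 1, ∀ y ∈ Set.Icc (0:ℝ) 1, x ≤ y → V x ≤ V y + e :=
      fun x hx y hy hxy => ih ⟨(⟨x, hx⟩, ⟨y, hy⟩), hxy⟩
    rintro ⟨⟨⟨x, hx⟩, ⟨y, hy⟩⟩, hxy⟩
    replace hxy : x ≤ y := hxy
    dsimp only
    rw [hVfix x hx, hVfix y hy, Bop, Bop, ← max_add_add_right]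
    refine max_le_max ?_ ?_
    · have h := mul_le_mul_of_nonneg_left
        (actCont_mono hp01 hp11 hε hp he hf hx hy hxy) hβ.1.le
      rw [actV_eq, actV_eq]
      linarith [mul_nonneg (sub_nonneg.2 hε.2.le) (sub_nonneg.2 hxy)]
    · have h := mul_le_mul_of_nonneg_left
        (hf _ (Tmap_mem hp01 hp11 hx) _ (Tmap_mem hp01 hp11 hy) <| by
          rw [← sub_nonneg, Tmap_sub]
          exact mul_nonneg (sub_nonneg.2 hp) (sub_nonneg.2 hxy)) hβ.1.le
      unfold pasV
      linarith

theorem exists_threshold {h : ℝ → ℝ} (hc : ContinuousOn h (Set.Icc 0 1))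
    (hm : MonotoneOn h (Set.Icc 0 1)) :
    ∃ t : ℝ, ∀ ω ∈ Set.Icc (0:ℝ) 1, 0 < h ω ↔ t < ω := by
  by_cases h0 : 0 < h 0
  · exact ⟨-1, fun ω hω => iff_of_true
      (h0.trans_le (hm (by simp) hω hω.1)) (by linarith [hω.1])⟩
  · have hK : IsCompact (Set.Icc (0:ℝ) 1 ∩ h ⁻¹' Set.Iic 0) :=
      isCompact_Icc.of_isClosed_subset
        (hc.preimage_isClosed_of_isClosed isClosed_Icc isClosed_Iic) Set.inter_subset_left
    obtain ⟨t, ⟨ht, ht0⟩, hmax⟩ := hK.exists_isGreatest ⟨0, by simp, not_lt.1 h0⟩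
    refine ⟨t, fun ω hω => ⟨fun hpos => ?_, fun hlt => ?_⟩⟩
    · by_contra! hle
      exact absurd (hm hω ht hle) (not_le.2 (lt_of_le_of_lt ht0 hpos))
    · by_contra! hle
      exact absurd (hmax ⟨hω, hle⟩) (not_le.2 hlt)

/-- Under the stated conditions on `β`, the infinite-horizon difference
`h(ω) = V_{β,m}(ω;u=1) − V_{β,m}(ω;u=0)` is monotonically nondecreasing on
`[0,1]`; consequently the infinite-horizon optimal single-arm policy is a
threshold policy. -/
theorem threshold_policy_infinite (p01 p11 ε β m : ℝ)
    (hp01 : p01 ∈ Set.Ioo (0:ℝ) 1) (hp11 : p11 ∈ Set.Ioo (0:ℝ) 1)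
    (hne : p01 ≠ p11) (hε : ε ∈ Set.Ioo (0:ℝ) 1) (hβ : β ∈ Set.Ioo (0:ℝ) 1)
    (hcond : (p01 < p11 ∧ β ≤ 1 / ((3 - ε) * (p11 - p01))) ∨
             (p11 < p01 ∧ β ≤ 1 / ((5 - 2 * ε) * (p01 - p11))))
    (V : ℝ → ℝ)
    (hVbdd : ∃ C, ∀ ω ∈ Set.Icc (0:ℝ) 1, |V ω| ≤ C)
    (hVfix : ∀ ω ∈ Set.Icc (0:ℝ) 1, V ω = Bop p01 p11 ε β m V ω) :
    (∀ ω ∈ Set.Icc (0:ℝ) 1, ∀ ω' ∈ Set.Icc (0:ℝ) 1, ω ≤ ω' →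
      actV p01 p11 ε β V ω - pasV p01 p11 β m V ω
        ≤ actV p01 p11 ε β V ω' - pasV p01 p11 β m V ω') ∧
    ∃ ωstar : ℝ, ∀ ω ∈ Set.Icc (0:ℝ) 1,
      actV p01 p11 ε β V ω > pasV p01 p11 β m V ω ↔ ω > ωstar := by
  set d := |p11 - p01| with hd
  have hd0 : 0 < d := abs_pos.2 (sub_ne_zero.2 hne.symm)
  have hε' : 0 < 1 - ε := sub_pos.2 hε.2
  have hcond' : (p01 < p11 ∧ β * d ≤ 1 / 2) ∨ β * d ≤ 1 / 3 := by
    rcases hcond with ⟨hp, hb⟩ | ⟨hp, hb⟩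
    · left
      have e : d = p11 - p01 := abs_of_pos (sub_pos.2 hp)
      rw [← e, le_div_iff₀ (mul_pos (by linarith [hε.2]) hd0)] at hb
      exact ⟨hp, by nlinarith [mul_pos hβ.1 hd0]⟩
    · right
      have e : d = p01 - p11 := by rw [hd, abs_sub_comm, abs_of_pos (sub_pos.2 hp)]
      rw [← e, le_div_iff₀ (mul_pos (by linarith [hε.2]) hd0)] at hb
      nlinarith [mul_pos hβ.1 hd0]
  have hk : 0 < 1 - β * d := by rcases hcond' with ⟨-, h⟩ | h <;> linarith
  obtain ⟨L, hL⟩ : ∃ L, L = (1 - ε) / (1 - β * d) := ⟨_, rfl⟩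
  have hL0 : 0 ≤ L := hL ▸ (div_pos hε' hk).le
  have hLeq : (1 - ε) + β * d * L = L := by
    rw [hL]; field_simp; ring
  have hLip := fixedPoint_lipschitz hp01 hp11 hε hβ hVbdd hVfix hL0 hLeq
  have hLip' : ∀ x ∈ Set.Icc (0:ℝ) 1, ∀ y ∈ Set.Icc (0:ℝ) 1, |V y - V x| ≤ L * |y - x| + 0 :=
    fun x hx y hy => (hLip x hx y hy).trans_eq (add_zero _).symm
  have hact : ∀ x ∈ Set.Icc (0:ℝ) 1, ∀ y ∈ Set.Icc (0:ℝ) 1, x ≤ y →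
      β * |actCont p01 p11 ε V y - actCont p01 p11 ε V x| ≤ β * d * L * (y - x) :=
    fun x hx y hy hxy => by
      have := mul_le_mul_of_nonneg_left
        (actCont_lipschitz hp01 hp11 hε le_rfl hLip' hx hy hxy) hβ.1.le
      linarith
  have hpas : ∀ x ∈ Set.Icc (0:ℝ) 1, ∀ y ∈ Set.Icc (0:ℝ) 1, x ≤ y →
      β * |V (Tmap p01 p11 y) - V (Tmap p01 p11 x)| ≤ β * d * L * (y - x) :=
    fun x hx y hy hxy => by
      have := mul_le_mul_of_nonneg_left
        (hLip _ (Tmap_mem hp01 hp11 hx) _ (Tmap_mem hp01 hp11 hy)) hβ.1.le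
      rw [Tmap_sub, abs_mul, abs_of_nonneg (sub_nonneg.2 hxy)] at this
      linarith
  have hsub : ∀ x y, (actV p01 p11 ε β V y - pasV p01 p11 β m V y) -
      (actV p01 p11 ε β V x - pasV p01 p11 β m V x) = (1 - ε) * (y - x) +
        β * (actCont p01 p11 ε V y - actCont p01 p11 ε V x) -
        β * (V (Tmap p01 p11 y) - V (Tmap p01 p11 x)) := fun x y => by
    simp only [actV_eq, pasV]; ring
  have hmono : ∀ x ∈ Set.Icc (0:ℝ) 1, ∀ y ∈ Set.Icc (0:ℝ) 1, x ≤ y →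
      actV p01 p11 ε β V x - pasV p01 p11 β m V x
        ≤ actV p01 p11 ε β V y - pasV p01 p11 β m V y := by
    intro x hx y hy hxy
    have hδ := sub_nonneg.2 hxy
    rw [← sub_nonneg, hsub]
    have h₁ := hact x hx y hy hxy
    have h₂ := hpas x hx y hy hxy
    have h₃ := mul_le_mul_of_nonneg_left
      (le_abs_self (V (Tmap p01 p11 y) - V (Tmap p01 p11 x))) hβ.1.le
    have h₄ := mul_le_mul_of_nonneg_left
      (neg_abs_le (actCont p01 p11 ε V y - actCont p01 p11 ε V x)) hβ.1.le
    have hLδ := mul_nonneg hL0 hδ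
    have h₅ := congrArg (fun z => z * (y - x)) hLeq
    rcases hcond' with ⟨hp, hb⟩ | hb
    · have hV := fixedPoint_mono hp01 hp11 hε hβ hVbdd hVfix hp.le
      have h₆ := actCont_mono hp01 hp11 hε hp.le le_rfl
        (fun x hx y hy hxy => (hV hx hy hxy).trans_eq (add_zero _).symm) hx hy hxy
      have h₇ := mul_nonneg hβ.1.le (sub_nonneg.2 h₆)
      have h₈ := mul_le_mul_of_nonneg_right hb hLδ
      linarith
    · have h₈ := mul_le_mul_of_nonneg_right hb hLδ
      linarith
  refine ⟨hmono, ?_⟩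
  have hcont : ContinuousOn (fun ω => actV p01 p11 ε β V ω - pasV p01 p11 β m V ω)
      (Set.Icc 0 1) := by
    have hK : 0 ≤ (1 - ε) + 2 * (β * d * L) := by have := hβ.1; positivity
    have main : ∀ x ∈ Set.Icc (0:ℝ) 1, ∀ y ∈ Set.Icc (0:ℝ) 1, x ≤ y →
        |(actV p01 p11 ε β V y - pasV p01 p11 β m V y) -
          (actV p01 p11 ε β V x - pasV p01 p11 β m V x)|
          ≤ ((1 - ε) + 2 * (β * d * L)) * |y - x| := by
      intro x hx y hy hxy
      have hδ := sub_nonneg.2 hxy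
      rw [hsub, abs_of_nonneg hδ]
      refine (abs_sub _ _).trans ((add_le_add_left (abs_add_le _ _) _).trans ?_)
      rw [abs_mul, abs_mul, abs_mul, abs_of_pos hβ.1, abs_of_pos hε', abs_of_nonneg hδ]
      linarith [hact x hx y hy hxy, hpas x hx y hy hxy]
    refine (LipschitzOnWith.of_dist_le_mul (K := Real.toNNReal ((1 - ε) + 2 * (β * d * L)))
      fun x hx y hy => ?_).continuousOn
    rw [Real.dist_eq, Real.dist_eq, Real.coe_toNNReal _ hK]
    rcases le_total x y with hxy | hxy
    · rw [abs_sub_comm, abs_sub_comm x y]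
      exact main x hx y hy hxy
    · exact main y hy x hx hxy
  obtain ⟨t, ht⟩ := exists_threshold hcont hmono
  exact ⟨t, fun ω hω => sub_pos.symm.trans (ht ω hω)⟩
end

section
/- Suppose p11 > p01 and let ω_o = p01/(1 + p01 − p11). Let L(ω, ω') = min{k ≥ 0 : T^k(ω) > ω'} denote the first crossing time. Then: (a) if ω ≤ ω' < ω_o with ω, ω' ∈ [0,1], the minimum is attained and L(ω, ω') = ⌊log((p01 − ω'(1 − p11 + p01))/(p01 − ω(1 − p11 + p01))) / log(p11 − p01)⌋ + 1; (b) if ω ≤ ω' and ω' ≥ ω_o, then T^k(ω) ≤ ω' for every k ≥ 0 (i.e., the crossing never occurs); (c) if ω > ω', then L(ω, ω') = 0. -/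
/-- The set of times `k` at which the iterated belief `T^k(ω)` exceeds the
threshold `ω'`; the first crossing time `L(ω,ω')` is its infimum. -/
def crossSet (p01 p11 ω ω' : ℝ) : Set ℕ := {k : ℕ | (Tmap p01 p11)^[k] ω > ω'}

/-- The affine functional `p01 − (1 − p11 + p01)·ω` is scaled by `p11 − p01` at each step. -/
theorem sub_iterate_Tmap_mul (p01 p11 ω : ℝ) (k : ℕ) :
    p01 - (Tmap p01 p11)^[k] ω * (1 - p11 + p01)
      = (p11 - p01) ^ k * (p01 - ω * (1 - p11 + p01)) := by
  induction k with
  | zero => simp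
  | succ k ih =>
    rw [Function.iterate_succ_apply', pow_succ', mul_assoc, ← ih, Tmap]
    ring

theorem lt_iterate_Tmap_iff {p01 p11 : ℝ} (hc : 0 < 1 - p11 + p01) (ω ω' : ℝ) (k : ℕ) :
    ω' < (Tmap p01 p11)^[k] ω ↔
      (p11 - p01) ^ k * (p01 - ω * (1 - p11 + p01)) < p01 - ω' * (1 - p11 + p01) := by
  rw [← sub_iterate_Tmap_mul, sub_lt_sub_iff_left, mul_lt_mul_iff_left₀ hc]

theorem pow_lt_iff_logb_lt {d x : ℝ} (hd : 0 < d) (hd1 : d < 1) (hx : 0 < x) (k : ℕ) :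
    d ^ k < x ↔ Real.logb d x < k := by
  rw [Real.logb_lt_iff_lt_rpow_of_base_lt_one hd hd1 hx, Real.rpow_natCast]

theorem Nat.sInf_setOf_lt_cast {x : ℝ} (hx : 0 ≤ x) :
    ((sInf {k : ℕ | x < k} : ℕ) : ℤ) = ⌊x⌋ + 1 := by
  have h : {k : ℕ | x < k} = Set.Ici (⌊x⌋₊ + 1) := by
    ext k
    simp [Nat.floor_lt hx]
  rw [h, csInf_Ici]
  push_cast
  rw [Int.natCast_floor_eq_floor hx]

/-- Closed form of the first crossing time `L(ω,ω') = min{k ≥ 0 : T^k(ω) > ω'}`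
when `p11 > p01`, with `ω_o = p01/(1 + p01 − p11)`:
(a) if `ω ≤ ω' < ω_o`, the crossing occurs and
`L(ω,ω') = ⌊log_{p11−p01}((p01 − ω'(1−p11+p01))/(p01 − ω(1−p11+p01)))⌋ + 1`;
(b) if `ω ≤ ω'` and `ω' ≥ ω_o`, the crossing never occurs;
(c) if `ω > ω'`, then `L(ω,ω') = 0`. -/
theorem first_crossing_time_pos (p01 p11 : ℝ)
    (hp01 : p01 ∈ Set.Ioo (0:ℝ) 1) (hp11 : p11 ∈ Set.Ioo (0:ℝ) 1)
    (hpos : p11 > p01) :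
    ∀ ω ∈ Set.Icc (0:ℝ) 1, ∀ ω' ∈ Set.Icc (0:ℝ) 1,
      (ω ≤ ω' → ω' < p01 / (1 + p01 - p11) →
        (crossSet p01 p11 ω ω').Nonempty ∧
        ((sInf (crossSet p01 p11 ω ω') : ℕ) : ℤ)
          = ⌊Real.logb (p11 - p01)
              ((p01 - ω' * (1 - p11 + p01)) / (p01 - ω * (1 - p11 + p01)))⌋ + 1) ∧
      (ω ≤ ω' → ω' ≥ p01 / (1 + p01 - p11) →
        ∀ k : ℕ, (Tmap p01 p11)^[k] ω ≤ ω') ∧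
      (ω > ω' → sInf (crossSet p01 p11 ω ω') = 0) := by
  obtain ⟨h0, -⟩ := hp01
  obtain ⟨-, h1⟩ := hp11
  have hc : 0 < 1 - p11 + p01 := by linarith
  have hd : 0 < p11 - p01 := by linarith
  have hd1 : p11 - p01 < 1 := by linarith
  have hc_comm : 1 + p01 - p11 = 1 - p11 + p01 := by ring
  intro ω _ ω' _
  rw [hc_comm]
  refine ⟨fun hle hlt => ?_, fun hle hge k => ?_, fun hgt => ?_⟩
  · rw [lt_div_iff₀ hc] at hlt
    have hB : 0 < p01 - ω' * (1 - p11 + p01) := by linarith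
    have hBA : p01 - ω' * (1 - p11 + p01) ≤ p01 - ω * (1 - p11 + p01) := by gcongr
    have hA := hB.trans_le hBA
    have hset : crossSet p01 p11 ω ω' = {k : ℕ | Real.logb (p11 - p01)
        ((p01 - ω' * (1 - p11 + p01)) / (p01 - ω * (1 - p11 + p01))) < k} := by
      ext k
      change ω' < _ ↔ Real.logb _ _ < (k : ℝ)
      rw [lt_iterate_Tmap_iff hc, ← lt_div_iff₀ hA, pow_lt_iff_logb_lt hd hd1 (div_pos hB hA)]
    rw [hset]
    exact ⟨exists_nat_gt (Real.logb _ _), Nat.sInf_setOf_lt_cast <|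
      Real.logb_nonneg_of_base_lt_one hd hd1 (div_pos hB hA) ((div_le_one hA).2 hBA)⟩
  · rw [ge_iff_le, div_le_iff₀ hc] at hge
    rw [← not_lt, lt_iterate_Tmap_iff hc, not_lt]
    have hBA : p01 - ω' * (1 - p11 + p01) ≤ p01 - ω * (1 - p11 + p01) := by gcongr
    have hk0 := pow_nonneg hd.le k
    have hk1 := pow_le_one₀ (n := k) hd.le hd1.le
    rcases le_total 0 (p01 - ω * (1 - p11 + p01)) with hA | hA
    · linarith [mul_nonneg hk0 hA]
    · linarith [mul_le_mul_of_nonpos_right hk1 hA]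
  · exact Nat.sInf_eq_zero.2 (Or.inl hgt)
end

section
/- Suppose p01 > p11 and let ω, ω' ∈ [0,1]. Then: (a) if ω > ω', the first crossing time L(ω, ω') = min{k ≥ 0 : T^k(ω) > ω'} equals 0; (b) if ω ≤ ω' and T(ω) > ω', then L(ω, ω') = 1; (c) if ω ≤ ω' and T(ω) ≤ ω', then T^k(ω) ≤ ω' for every k ≥ 0 (i.e., the crossing never occurs). -/
/-- Applying `Tmap` twice gives a convex combination of `ω` and `Tmap p01 p11 ω`. -/
theorem Tmap_Tmap (p01 p11 ω : ℝ) :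
    Tmap p01 p11 (Tmap p01 p11 ω) =
      (1 - (p01 - p11)) * Tmap p01 p11 ω + (p01 - p11) * ω := by
  unfold Tmap
  ring

theorem iterate_Tmap_le {p01 p11 : ℝ} (h0 : 0 ≤ p01 - p11) (h1 : p01 - p11 ≤ 1) {b : ℝ} (k : ℕ) :
    ∀ {ω : ℝ}, ω ≤ b → Tmap p01 p11 ω ≤ b → (Tmap p01 p11)^[k] ω ≤ b := by
  induction k with
  | zero => exact fun h _ => h
  | succ k ih =>
    intro ω h hT
    rw [Function.iterate_succ_apply]
    refine ih hT ?_
    rw [Tmap_Tmap]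
    nlinarith [mul_le_mul_of_nonneg_left h h0, mul_le_mul_of_nonneg_left hT (sub_nonneg.2 h1)]

/-- First crossing time `L(ω,ω') = min{k ≥ 0 : T^k(ω) > ω'}` when `p01 > p11`:
(a) if `ω > ω'`, then `L(ω,ω') = 0`;
(b) if `ω ≤ ω'` and `T(ω) > ω'`, then `L(ω,ω') = 1`;
(c) if `ω ≤ ω'` and `T(ω) ≤ ω'`, the crossing never occurs. -/
theorem first_crossing_time_neg (p01 p11 : ℝ)
    (hp01 : p01 ∈ Set.Ioo (0:ℝ) 1) (hp11 : p11 ∈ Set.Ioo (0:ℝ) 1)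
    (hneg : p01 > p11) :
    ∀ ω ∈ Set.Icc (0:ℝ) 1, ∀ ω' ∈ Set.Icc (0:ℝ) 1,
      (ω > ω' → sInf (crossSet p01 p11 ω ω') = 0) ∧
      (ω ≤ ω' → Tmap p01 p11 ω > ω' → sInf (crossSet p01 p11 ω ω') = 1) ∧
      (ω ≤ ω' → Tmap p01 p11 ω ≤ ω' → ∀ k : ℕ, (Tmap p01 p11)^[k] ω ≤ ω') := by
  intro ω _ ω' _
  refine ⟨fun h => ?_, fun h hT => ?_, fun h hT k => ?_⟩
  · exact Nat.sInf_eq_zero.2 (Or.inl h)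
  · have hmem : 1 ∈ crossSet p01 p11 ω ω' := hT
    refine le_antisymm (Nat.sInf_le hmem) (le_csInf ⟨1, hmem⟩ fun k hk => ?_)
    refine Nat.one_le_iff_ne_zero.2 ?_
    rintro rfl
    exact absurd hk (not_lt.2 h)
  · exact iterate_Tmap_le (by linarith) (by linarith [hp01.2, hp11.1]) k h hT
end
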